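/- arXiv:2112.03428 — 2 statements merged into one kernel-verified Lean document; each statement's English description precedes it below -/
import Mathlib

section
/- Suppose ε_m ≥ 0 satisfies |P_D(D(f)) − P(f)| ≤ ε_m for all f ∈ 𝓕, and δ_m ≥ 0 satisfies |Ω_{x_i}(D(f)) − f(x_i)| ≤ δ_m for all f ∈ 𝓕 and all i = 1, …, n. Then for every f ∈ 𝓕, L_D(D(f)) ≤ L(f) + δ_m² + 2 ‖y − f(x)‖_n δ_m + ε_m λ, where ‖y − f(x)‖_n := ((1/n)∑_{i=1}^n (y_i − f(x_i))²)^{1/2}. -/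
/-- The mean of absolute values is at most the root mean square. -/
theorem mean_abs_le_sqrt_mean_sq {n : ℕ} (hn : 1 ≤ n) (r : Fin n → ℝ) :
    (1 / n) * ∑ i, |r i| ≤ Real.sqrt ((1 / n) * ∑ i, r i ^ 2) := by
  have hn0 : (0 : ℝ) < n := by exact_mod_cast hn
  apply Real.le_sqrt_of_sq_le
  have h := sq_sum_le_card_mul_sum_sq (s := Finset.univ) (f := fun i => |r i|)
  simp only [sq_abs, Finset.card_univ, Fintype.card_fin] at h
  calc ((1 / n) * ∑ i, |r i|) ^ 2 = (1 / (n : ℝ)) ^ 2 * (∑ i, |r i|) ^ 2 := by ring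
    _ ≤ (1 / (n : ℝ)) ^ 2 * (n * ∑ i, r i ^ 2) := by gcongr
    _ = (1 / n) * ∑ i, r i ^ 2 := by field_simp

/-- Perturbing each residual by at most `δ` changes the mean square in a controlled way. -/
theorem mean_sq_sub_le {n : ℕ} (hn : 1 ≤ n) (r e : Fin n → ℝ) {δ : ℝ} (hδ : 0 ≤ δ)
    (he : ∀ i, |e i| ≤ δ) :
    (1 / n) * ∑ i, (r i - e i) ^ 2 ≤
      (1 / n) * ∑ i, r i ^ 2 + δ ^ 2 + 2 * Real.sqrt ((1 / n) * ∑ i, r i ^ 2) * δ := by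
  have hn0 : (0 : ℝ) < n := by exact_mod_cast hn
  have hpt (i : Fin n) : (r i - e i) ^ 2 ≤ r i ^ 2 + δ ^ 2 + 2 * δ * |r i| := by
    have h : |r i - e i| ≤ |r i| + δ := (abs_sub _ _).trans (by gcongr; exact he i)
    calc (r i - e i) ^ 2 = |r i - e i| ^ 2 := (sq_abs _).symm
      _ ≤ (|r i| + δ) ^ 2 := by gcongr
      _ = r i ^ 2 + δ ^ 2 + 2 * δ * |r i| := by rw [← sq_abs (r i)]; ring
  calc (1 / n) * ∑ i, (r i - e i) ^ 2
      ≤ (1 / (n : ℝ)) * ∑ i, (r i ^ 2 + δ ^ 2 + 2 * δ * |r i|) := by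
        gcongr with i; exact hpt i
    _ = (1 / n) * ∑ i, r i ^ 2 + δ ^ 2 + 2 * ((1 / n) * ∑ i, |r i|) * δ := by
        rw [Finset.sum_add_distrib, Finset.sum_add_distrib, ← Finset.mul_sum]
        simp only [Finset.sum_const, Finset.card_univ, Fintype.card_fin, nsmul_eq_mul]
        field_simp
    _ ≤ _ := by gcongr; exact mean_abs_le_sqrt_mean_sq hn r

/-- If the penalty approximation error is uniformly bounded by `ε_m` over `𝓕`
and the interpolation error at the sample points is uniformly bounded by `δ_m` over `𝓕`,
then for every `f ∈ 𝓕`,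
`L_D (D f) ≤ L f + δ_m² + 2 ‖y − f(x)‖_n δ_m + ε_m λ`,
where `‖y − f(x)‖_n = ((1/n)∑ (y_i − f(x_i))²)^{1/2}`. -/
theorem mbs_mesh_loss_of_gridded {n m : ℕ} (hn : 1 ≤ n) (hm : 1 ≤ m)
    (a b : ℝ) (hab : a ≤ b)
    (x : Fin n → ℝ) (hx : ∀ i, x i ∈ Set.Icc a b)
    (y : Fin n → ℝ) (lam : ℝ) (hlam : 0 ≤ lam)
    (d : Fin m → ℝ) (hd : Monotone d)
    (hda : d ⟨0, hm⟩ = a) (hdb : d ⟨m - 1, Nat.sub_lt hm one_pos⟩ = b)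
    (𝓕 : Set (ℝ → ℝ)) (P : (ℝ → ℝ) → ℝ) (hP : ∀ f, 0 ≤ P f)
    (PD : (Fin m → ℝ) → ℝ) (Ω : (Fin m → ℝ) → (ℝ → ℝ))
    (L : (ℝ → ℝ) → ℝ)
    (hL : ∀ f : ℝ → ℝ, L f = (1 / n) * ∑ i, (y i - f (x i)) ^ 2 + lam * P f)
    (LD : (Fin m → ℝ) → ℝ)
    (hLD : ∀ v : Fin m → ℝ, LD v = (1 / n) * ∑ i, (y i - Ω v (x i)) ^ 2 + lam * PD v)
    (εm : ℝ) (hεm : 0 ≤ εm)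
    (hPD : ∀ f ∈ 𝓕, |PD (fun j => f (d j)) - P f| ≤ εm)
    (δm : ℝ) (hδm : 0 ≤ δm)
    (hΩerr : ∀ f ∈ 𝓕, ∀ i : Fin n, |Ω (fun j => f (d j)) (x i) - f (x i)| ≤ δm) :
    ∀ f ∈ 𝓕,
      LD (fun j => f (d j)) ≤
        L f + δm ^ 2
          + 2 * Real.sqrt ((1 / n) * ∑ i, (y i - f (x i)) ^ 2) * δm
          + εm * lam := by
  intro f hf
  rw [hL, hLD]
  have h := mean_sq_sub_le hn (fun i => y i - f (x i))
    (fun i => Ω (fun j => f (d j)) (x i) - f (x i)) hδm (hΩerr f hf)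
  simp only [sub_sub_sub_cancel_right] at h
  have hpen := mul_le_mul_of_nonneg_left (abs_le.mp (hPD f hf)).2 hlam
  linarith
end

section
/- (Sub-optimality inequality, first branch, deterministic form with explicit constants.) Suppose: (i) for every v ∈ ℝ^m, Ω(v) ∈ 𝓕 and Ω(v)(d_j) = v_j for all j; (ii) ε_m ≥ 0 satisfies |P_D(D(f)) − P(f)| ≤ ε_m for all f ∈ 𝓕; (iii) δ_m ≥ 0 satisfies |Ω_{x_i}(D(f)) − f(x_i)| ≤ δ_m for all f ∈ 𝓕 and all i; (iv) f̂ ∈ 𝓕 satisfies L(f̂) ≤ L(f) for all f ∈ 𝓕; and (v) f̃ ∈ ℝ^m satisfies L_D(f̃) ≤ L_D(v) for all v ∈ ℝ^m. Then L(Ω(f̃)) ≤ 3 L(f̂) + 3 δ_m² + 2 ε_m λ. -/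
/-- Sub-optimality inequality, first branch, deterministic form:
under the interpolation/penalty-approximation assumptions, if `f̂` minimizes `L` over `𝓕`
and `f̃` minimizes `L_D` over `ℝ^m`, then `L (Ω f̃) ≤ 3 L f̂ + 3 δ_m² + 2 ε_m λ`. -/
theorem mbs_suboptimality_first_branch {n m : ℕ} (hn : 1 ≤ n) (hm : 1 ≤ m)
    (a b : ℝ) (hab : a ≤ b)
    (x : Fin n → ℝ) (hx : ∀ i, x i ∈ Set.Icc a b)
    (y : Fin n → ℝ) (lam : ℝ) (hlam : 0 ≤ lam)
    (d : Fin m → ℝ) (hd : Monotone d)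
    (hda : d ⟨0, hm⟩ = a) (hdb : d ⟨m - 1, Nat.sub_lt hm one_pos⟩ = b)
    (𝓕 : Set (ℝ → ℝ)) (P : (ℝ → ℝ) → ℝ) (hP : ∀ f, 0 ≤ P f)
    (PD : (Fin m → ℝ) → ℝ) (Ω : (Fin m → ℝ) → (ℝ → ℝ))
    (L : (ℝ → ℝ) → ℝ)
    (hL : ∀ f : ℝ → ℝ, L f = (1 / n) * ∑ i, (y i - f (x i)) ^ 2 + lam * P f)
    (LD : (Fin m → ℝ) → ℝ)
    (hLD : ∀ v : Fin m → ℝ, LD v = (1 / n) * ∑ i, (y i - Ω v (x i)) ^ 2 + lam * PD v)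
    (hΩF : ∀ v : Fin m → ℝ, Ω v ∈ 𝓕)
    (hΩd : ∀ (v : Fin m → ℝ) (j : Fin m), Ω v (d j) = v j)
    (εm : ℝ) (hεm : 0 ≤ εm)
    (hPD : ∀ f ∈ 𝓕, |PD (fun j => f (d j)) - P f| ≤ εm)
    (δm : ℝ) (hδm : 0 ≤ δm)
    (hΩerr : ∀ f ∈ 𝓕, ∀ i : Fin n, |Ω (fun j => f (d j)) (x i) - f (x i)| ≤ δm)
    (fhat : ℝ → ℝ) (hfhat : fhat ∈ 𝓕) (hopt : ∀ f ∈ 𝓕, L fhat ≤ L f)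
    (ftilde : Fin m → ℝ) (hoptD : ∀ v : Fin m → ℝ, LD ftilde ≤ LD v) :
    L (Ω ftilde) ≤ 3 * L fhat + 3 * δm ^ 2 + 2 * εm * lam := by
  have hn0 : (0 : ℝ) < n := by exact_mod_cast hn
  have hgrid : (fun j => Ω ftilde (d j)) = ftilde := funext (hΩd ftilde)
  have hPtilde := (abs_le.mp (hPD _ (hΩF ftilde))).1
  rw [hgrid] at hPtilde
  have hPhat := (abs_le.mp (hPD fhat hfhat)).2
  have hmin := hoptD (fun j => fhat (d j))
  rw [hLD, hLD] at hmin
  have hsum : (1 / n : ℝ) * ∑ i, (y i - Ω (fun j => fhat (d j)) (x i)) ^ 2 ≤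
      2 * ((1 / n) * ∑ i, (y i - fhat (x i)) ^ 2) + 2 * δm ^ 2 :=
    calc (1 / n : ℝ) * ∑ i, (y i - Ω (fun j => fhat (d j)) (x i)) ^ 2
        ≤ (1 / n) * ∑ i, (2 * (y i - fhat (x i)) ^ 2 + 2 * δm ^ 2) := by
          gcongr with i
          have herr := sq_le_sq' (abs_le.mp (hΩerr fhat hfhat i)).1
            (abs_le.mp (hΩerr fhat hfhat i)).2
          nlinarith [sq_nonneg ((y i - fhat (x i)) +
            (Ω (fun j => fhat (d j)) (x i) - fhat (x i)))]
      _ = 2 * ((1 / n) * ∑ i, (y i - fhat (x i)) ^ 2) + 2 * δm ^ 2 := by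
          rw [Finset.sum_add_distrib, ← Finset.mul_sum]
          simp only [Finset.sum_const, Finset.card_univ, Fintype.card_fin, nsmul_eq_mul]
          field_simp
  have hmse : 0 ≤ (1 / n : ℝ) * ∑ i, (y i - fhat (x i)) ^ 2 := by positivity
  have hpen : 0 ≤ lam * P fhat := mul_nonneg hlam (hP fhat)
  rw [hL, hL]
  nlinarith [mul_le_mul_of_nonneg_left hPtilde hlam, mul_le_mul_of_nonneg_left hPhat hlam,
    sq_nonneg δm]
end
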